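/- Let α ∈ (0,1) and ρ ∈ (−1,1), and let f : ℝ → [−1,1] be measurable and a global minimizer of L(f) = ((1−α)/α)·∫_ℝ f(x)² φ(x) dx + ∫_{ℝ²} f(x) f(y) φ_ρ(x,y) dx dy over all measurable functions ℝ → [−1,1]. Suppose a′ > 0 and δ > 0 are such that |f(x)| ≤ 1 − δ for all x ∈ (−a′, a′). Then for almost every y ∈ (−a′, a′), ((1−α)/α)·f(y)·φ(y) + ∫_ℝ f(x)·φ_ρ(x,y) dx = 0. -/

import Mathlib

open MeasureTheory

/-- The standard Gaussian density on `ℝ`. -/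
noncomputable def phi (x : ℝ) : ℝ :=
  (1 / Real.sqrt (2 * Real.pi)) * Real.exp (-x ^ 2 / 2)

/-- The density of a centered bivariate Gaussian with unit variances and
correlation `ρ`. -/
noncomputable def phiRho (ρ x y : ℝ) : ℝ :=
  Real.exp (-(x ^ 2 - 2 * ρ * x * y + y ^ 2) / (2 * (1 - ρ ^ 2))) /
    (2 * Real.pi * Real.sqrt (1 - ρ ^ 2))

/-- The MAX CUT rounding functional
`L(f) = ((1−α)/α)·∫ f(x)² φ(x) dx + ∫∫ f(x)f(y) φ_ρ(x,y) dx dy`. -/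
noncomputable def Lfun (α ρ : ℝ) (f : ℝ → ℝ) : ℝ :=
  ((1 - α) / α) * (∫ x, (f x) ^ 2 * phi x) +
    ∫ p : ℝ × ℝ, f p.1 * f p.2 * phiRho ρ p.1 p.2

/-- A real quadratic without constant term that is nonnegative near the origin has no linear
term. -/
theorem linear_coeff_eq_zero_of_nonneg {S Q δ : ℝ} (hδ : 0 < δ)
    (h : ∀ t : ℝ, |t| ≤ δ → 0 ≤ t * S + t ^ 2 * Q) : S = 0 := by
  have hmin : IsLocalMin (fun t : ℝ => t * S + t ^ 2 * Q) 0 := by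
    filter_upwards [Metric.closedBall_mem_nhds (0 : ℝ) hδ] with t ht
    have ht' : |t| ≤ δ := by simpa [Real.dist_eq] using ht
    simpa using h t ht'
  have hd : HasDerivAt (fun t : ℝ => t * S + t ^ 2 * Q) S 0 := by
    simpa using ((hasDerivAt_id' (0 : ℝ)).mul_const S).fun_add
      (((hasDerivAt_id' (0 : ℝ)).fun_pow 2).mul_const Q)
  exact hmin.hasDerivAt_eq_zero hd

theorem integrable_phi : Integrable phi := by
  have h := (integrable_exp_neg_mul_sq (b := 1 / 2) (by norm_num)).const_mul
    (1 / Real.sqrt (2 * Real.pi))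
  refine h.congr (Filter.Eventually.of_forall fun x => ?_)
  simp only [phi]
  ring_nf

theorem phiRho_comm (ρ x y : ℝ) : phiRho ρ x y = phiRho ρ y x := by
  unfold phiRho
  ring_nf

theorem continuous_phiRho (ρ : ℝ) : Continuous fun p : ℝ × ℝ => phiRho ρ p.1 p.2 := by
  unfold phiRho
  fun_prop

theorem integrable_phiRho {ρ : ℝ} (hρ : ρ ∈ Set.Ioo (-1 : ℝ) 1) :
    Integrable fun p : ℝ × ℝ => phiRho ρ p.1 p.2 := by
  have habs : |ρ| < 1 := abs_lt.2 hρ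
  have hvar : 0 < 1 - ρ ^ 2 := by nlinarith [hρ.1, hρ.2]
  set b : ℝ := (1 - |ρ|) / (2 * (1 - ρ ^ 2)) with hb
  have hb0 : 0 < b := div_pos (by linarith) (by linarith)
  have hdom : Integrable fun p : ℝ × ℝ =>
      Real.exp (-b * p.1 ^ 2) * Real.exp (-b * p.2 ^ 2) :=
    (integrable_exp_neg_mul_sq hb0).mul_prod (integrable_exp_neg_mul_sq hb0)
  refine (hdom.div_const (2 * Real.pi * Real.sqrt (1 - ρ ^ 2))).mono'
    (continuous_phiRho ρ).aestronglyMeasurable (Filter.Eventually.of_forall fun p => ?_)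
  have hpos : 0 ≤ phiRho ρ p.1 p.2 := by
    unfold phiRho
    positivity
  rw [Real.norm_of_nonneg hpos, ← Real.exp_add]
  unfold phiRho
  gcongr
  have hsum : -b * p.1 ^ 2 + -b * p.2 ^ 2 =
      (-((1 - |ρ|) * (p.1 ^ 2 + p.2 ^ 2))) / (2 * (1 - ρ ^ 2)) := by
    rw [hb]
    ring
  rw [hsum]
  gcongr
  have hcross : ρ * (p.1 * p.2) ≤ |ρ| * (|p.1| * |p.2|) := by
    rw [← abs_mul, ← abs_mul]
    exact le_abs_self _
  nlinarith [mul_nonneg (abs_nonneg ρ) (sq_nonneg (|p.1| - |p.2|)), sq_abs p.1, sq_abs p.2]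

theorem integrable_mul_mul_phi {u v : ℝ → ℝ} (hu : Measurable u) (hv : Measurable v)
    (hu1 : ∀ x, |u x| ≤ 1) (hv1 : ∀ x, |v x| ≤ 1) :
    Integrable fun x => u x * v x * phi x := by
  refine integrable_phi.bdd_mul (hu.mul hv).aestronglyMeasurable (c := 1)
    (Filter.Eventually.of_forall fun x => ?_)
  rw [Real.norm_eq_abs, abs_mul]
  exact mul_le_one₀ (hu1 x) (abs_nonneg _) (hv1 x)

theorem integrable_mul_mul_phiRho {ρ : ℝ} (hρ : ρ ∈ Set.Ioo (-1 : ℝ) 1) {u v : ℝ → ℝ}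
    (hu : Measurable u) (hv : Measurable v) (hu1 : ∀ x, |u x| ≤ 1) (hv1 : ∀ x, |v x| ≤ 1) :
    Integrable fun p : ℝ × ℝ => u p.1 * v p.2 * phiRho ρ p.1 p.2 := by
  refine (integrable_phiRho hρ).bdd_mul
    ((hu.comp measurable_fst).mul (hv.comp measurable_snd)).aestronglyMeasurable (c := 1)
    (Filter.Eventually.of_forall fun p => ?_)
  rw [Real.norm_eq_abs, abs_mul]
  exact mul_le_one₀ (hu1 p.1) (abs_nonneg _) (hv1 p.2)

theorem integral_mul_mul_phiRho_comm (ρ : ℝ) (u v : ℝ → ℝ) :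
    (∫ p : ℝ × ℝ, u p.1 * v p.2 * phiRho ρ p.1 p.2) =
      ∫ p : ℝ × ℝ, v p.1 * u p.2 * phiRho ρ p.1 p.2 := by
  have h := integral_prod_swap (μ := (volume : Measure ℝ)) (ν := (volume : Measure ℝ))
    (fun p : ℝ × ℝ => v p.1 * u p.2 * phiRho ρ p.1 p.2)
  rw [← Measure.volume_eq_prod] at h
  rw [← h]
  refine integral_congr_ae (Filter.Eventually.of_forall fun p => ?_)
  simp only [Prod.fst_swap, Prod.snd_swap]
  rw [phiRho_comm]
  ring

/-- Second-order expansion of `Lfun` along a bounded direction. -/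
theorem Lfun_add_mul {α ρ : ℝ} (hρ : ρ ∈ Set.Ioo (-1 : ℝ) 1) {f h : ℝ → ℝ}
    (hf : Measurable f) (hh : Measurable h) (hf1 : ∀ x, |f x| ≤ 1) (hh1 : ∀ x, |h x| ≤ 1)
    (t : ℝ) :
    Lfun α ρ (fun x => f x + t * h x) = Lfun α ρ f +
      t * (2 * (((1 - α) / α) * (∫ x, f x * h x * phi x) +
        ∫ p : ℝ × ℝ, f p.1 * h p.2 * phiRho ρ p.1 p.2)) + t ^ 2 * Lfun α ρ h := by
  have hsq : (∫ x, (f x + t * h x) ^ 2 * phi x) = (∫ x, f x ^ 2 * phi x) +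
      2 * t * (∫ x, f x * h x * phi x) + t ^ 2 * ∫ x, h x ^ 2 * phi x := by
    have hff := integrable_mul_mul_phi hf hf hf1 hf1
    have hfh := (integrable_mul_mul_phi hf hh hf1 hh1).const_mul (2 * t)
    have hhh := (integrable_mul_mul_phi hh hh hh1 hh1).const_mul (t ^ 2)
    simp only [← sq] at hff hhh
    rw [← integral_const_mul, ← integral_const_mul, ← integral_add hff hfh,
      ← integral_add (hff.fun_add hfh) hhh]
    refine integral_congr_ae (Filter.Eventually.of_forall fun x => ?_)
    ring
  have hbil : (∫ p : ℝ × ℝ, (f p.1 + t * h p.1) * (f p.2 + t * h p.2) * phiRho ρ p.1 p.2) =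
      (∫ p : ℝ × ℝ, f p.1 * f p.2 * phiRho ρ p.1 p.2) +
      t * (∫ p : ℝ × ℝ, f p.1 * h p.2 * phiRho ρ p.1 p.2) +
      t * (∫ p : ℝ × ℝ, h p.1 * f p.2 * phiRho ρ p.1 p.2) +
      t ^ 2 * ∫ p : ℝ × ℝ, h p.1 * h p.2 * phiRho ρ p.1 p.2 := by
    have hff := integrable_mul_mul_phiRho hρ hf hf hf1 hf1
    have hfh := (integrable_mul_mul_phiRho hρ hf hh hf1 hh1).const_mul t
    have hhf := (integrable_mul_mul_phiRho hρ hh hf hh1 hf1).const_mul t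
    have hhh := (integrable_mul_mul_phiRho hρ hh hh hh1 hh1).const_mul (t ^ 2)
    rw [← integral_const_mul, ← integral_const_mul, ← integral_const_mul,
      ← integral_add hff hfh, ← integral_add (hff.fun_add hfh) hhf,
      ← integral_add ((hff.fun_add hfh).fun_add hhf) hhh]
    refine integral_congr_ae (Filter.Eventually.of_forall fun p => ?_)
    ring
  unfold Lfun
  rw [hsq, hbil, integral_mul_mul_phiRho_comm ρ h f]
  ring

/-- Euler–Lagrange (Fredholm) equation for the optimal MAX CUT rounding
function: if `f` is a global minimizer of `L` over measurable functions
`ℝ → [−1,1]` and `|f| ≤ 1 − δ` on `(−a′, a′)` for some `a′, δ > 0`, then for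
almost every `y ∈ (−a′, a′)`,
`((1−α)/α)·f(y)·φ(y) + ∫ f(x)·φ_ρ(x,y) dx = 0`. -/
theorem euler_lagrange_maxcut (α ρ : ℝ)
    (hα : α ∈ Set.Ioo (0 : ℝ) 1) (hρ : ρ ∈ Set.Ioo (-1 : ℝ) 1)
    (f : ℝ → ℝ) (hfmeas : Measurable f) (hf1 : ∀ x, f x ∈ Set.Icc (-1 : ℝ) 1)
    (hmin : ∀ g : ℝ → ℝ, Measurable g → (∀ x, g x ∈ Set.Icc (-1 : ℝ) 1) →
      Lfun α ρ f ≤ Lfun α ρ g)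
    (a' δ : ℝ) (ha' : 0 < a') (hδ : 0 < δ)
    (hint : ∀ x ∈ Set.Ioo (-a') a', |f x| ≤ 1 - δ) :
    ∀ᵐ y ∂(volume : Measure ℝ), y ∈ Set.Ioo (-a') a' →
      ((1 - α) / α) * f y * phi y + (∫ x, f x * phiRho ρ x y) = 0 := by
  have hfabs : ∀ x, |f x| ≤ 1 := fun x => abs_le.2 (hf1 x)
  have hone : ∀ x : ℝ, |(fun _ : ℝ => (1 : ℝ)) x| ≤ 1 := by simp
  have hlocal : Integrable fun y => ((1 - α) / α) * f y * phi y := by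
    refine ((integrable_mul_mul_phi hfmeas measurable_const hfabs hone).const_mul
      ((1 - α) / α)).congr (Filter.Eventually.of_forall fun y => ?_)
    ring
  have hkernel : Integrable fun y => ∫ x, f x * phiRho ρ x y := by
    simpa using
      (integrable_mul_mul_phiRho hρ hfmeas measurable_const hfabs hone).integral_prod_right
  suffices hzero : (fun y => ((1 - α) / α) * f y * phi y + ∫ x, f x * phiRho ρ x y)
      =ᵐ[volume.restrict (Set.Ioo (-a') a')] 0 from
    (ae_restrict_iff' measurableSet_Ioo).1 hzero
  refine (hlocal.add hkernel).restrict.ae_eq_zero_of_forall_setIntegral_eq_zero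
    fun s hs _ => ?_
  rw [Measure.restrict_restrict hs]
  set A : Set ℝ := s ∩ Set.Ioo (-a') a' with hA
  have hAmeas : MeasurableSet A := hs.inter measurableSet_Ioo
  set h : ℝ → ℝ := A.indicator fun _ => 1 with hh
  have hhmeas : Measurable h := measurable_const.indicator hAmeas
  have hh1 : ∀ x, |h x| ≤ 1 := fun x => by
    by_cases hx : x ∈ A <;> simp [hh, hx]
  have hvar := linear_coeff_eq_zero_of_nonneg hδ
    (S := 2 * (((1 - α) / α) * (∫ x, f x * h x * phi x) +
      ∫ p : ℝ × ℝ, f p.1 * h p.2 * phiRho ρ p.1 p.2)) (Q := Lfun α ρ h) fun t ht => by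
    have hle := hmin (fun x => f x + t * h x) (hfmeas.add (hhmeas.const_mul t)) fun x => by
      by_cases hx : x ∈ A
      · have hfx := abs_le.1 (hint x hx.2)
        have htx := abs_le.1 ht
        simp only [hh, Set.indicator_of_mem hx]
        constructor <;> linarith [hfx.1, hfx.2, htx.1, htx.2]
      · simpa [hh, hx] using hf1 x
    rw [Lfun_add_mul hρ hfmeas hhmeas hfabs hh1] at hle
    linarith
  have hfub : (∫ p : ℝ × ℝ, f p.1 * h p.2 * phiRho ρ p.1 p.2) =
      ∫ y in A, ∫ x, f x * phiRho ρ x y := by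
    rw [Measure.volume_eq_prod, integral_prod_symm _
      (integrable_mul_mul_phiRho hρ hfmeas hhmeas hfabs hh1), ← integral_indicator hAmeas]
    refine integral_congr_ae (Filter.Eventually.of_forall fun y => ?_)
    by_cases hy : y ∈ A <;> simp [hh, hy]
  have hset : ((1 - α) / α) * (∫ x, f x * h x * phi x) =
      ∫ y in A, ((1 - α) / α) * f y * phi y := by
    rw [← integral_const_mul, ← integral_indicator hAmeas]
    refine integral_congr_ae (Filter.Eventually.of_forall fun y => ?_)
    by_cases hy : y ∈ A <;> simp [hh, hy, mul_assoc]
  simp only [Pi.add_apply]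
  rw [integral_add hlocal.integrableOn hkernel.integrableOn, ← hset, ← hfub]
  linarith
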